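/- Let Q ⊆ ℝⁿ × ℝ be an open set, let Φ and F be smooth real-valued functions on Q, and let u ∈ C_0^∞(Q). Set v = e^Φ u. Then ∫_Q e^{2Φ} |∂_t u + Δu|² dx dt ≥ ∫_Q [ 4⟨D²Φ ∇v, ∇v⟩ + F |∇v|² ] dx dt + ∫_Q [ 4⟨D²Φ ∇Φ, ∇Φ⟩ − 2 ∂_t(|∇Φ|²) + ∂_tt Φ − Δ²Φ ] v² dx dt + ∫_Q [ −(1/2) ∂_t F − (1/2) ΔF + ∇Φ·∇F − F(|∇Φ|² − ∂_t Φ + F/2) ] v² dx dt. -/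

import Mathlib

open Set MeasureTheory
open scoped RealInnerProductSpace

/-- The Laplacian (in the `x` variables) of `g : ℝⁿ → ℝ` at `x`. -/
noncomputable def lap {n : ℕ} (g : EuclideanSpace ℝ (Fin n) → ℝ)
    (x : EuclideanSpace ℝ (Fin n)) : ℝ :=
  ∑ i : Fin n, iteratedFDeriv ℝ 2 g x
    ![EuclideanSpace.single i 1, EuclideanSpace.single i 1]

/-- The Hessian quadratic form `⟨D²g(x) ξ, ξ⟩` of `g` at `x` applied to `ξ`. -/
noncomputable def hessQ {n : ℕ} (g : EuclideanSpace ℝ (Fin n) → ℝ)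
    (x ξ : EuclideanSpace ℝ (Fin n)) : ℝ :=
  iteratedFDeriv ℝ 2 g x ![ξ, ξ]


open Filter Topology
open scoped ContDiff

noncomputable section

abbrev Sp (n : ℕ) := EuclideanSpace ℝ (Fin n) × ℝ

/-- directional derivative -/
def Dd {n : ℕ} (e : Sp n) (f : Sp n → ℝ) (p : Sp n) : ℝ := fderiv ℝ f p e

def ex {n : ℕ} (i : Fin n) : Sp n := (EuclideanSpace.single i 1, 0)
def et {n : ℕ} : Sp n := (0, 1)

@[fun_prop]
lemma Dd_smooth {n : ℕ} (e : Sp n) (f : Sp n → ℝ) (hf : ContDiff ℝ ∞ f) :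
    ContDiff ℝ ∞ (Dd e f) := by
  unfold Dd
  exact (hf.fderiv_right (m := ∞) (by simp)).clm_apply contDiff_const

lemma Dd_mul {n : ℕ} (e : Sp n) (f g : Sp n → ℝ) (hf : ContDiff ℝ ∞ f) (hg : ContDiff ℝ ∞ g) :
    Dd e (fun p => f p * g p) = fun p => Dd e f p * g p + f p * Dd e g p := by
  funext p
  have h1 := (hf.differentiable (by simp) p).hasFDerivAt
  have h2 := (hg.differentiable (by simp) p).hasFDerivAt
  unfold Dd
  rw [(h1.fun_mul h2).fderiv]
  simp
  ring

lemma Dd_add {n : ℕ} (e : Sp n) (f g : Sp n → ℝ) (hf : ContDiff ℝ ∞ f) (hg : ContDiff ℝ ∞ g) :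
    Dd e (fun p => f p + g p) = fun p => Dd e f p + Dd e g p := by
  funext p
  have h1 := (hf.differentiable (by simp) p).hasFDerivAt
  have h2 := (hg.differentiable (by simp) p).hasFDerivAt
  unfold Dd
  rw [(h1.fun_add h2).fderiv]
  simp

lemma Dd_sub {n : ℕ} (e : Sp n) (f g : Sp n → ℝ) (hf : ContDiff ℝ ∞ f) (hg : ContDiff ℝ ∞ g) :
    Dd e (fun p => f p - g p) = fun p => Dd e f p - Dd e g p := by
  funext p
  have h1 := (hf.differentiable (by simp) p).hasFDerivAt
  have h2 := (hg.differentiable (by simp) p).hasFDerivAt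
  unfold Dd
  rw [(h1.fun_sub h2).fderiv]
  simp

lemma Dd_cmul {n : ℕ} (e : Sp n) (c : ℝ) (f : Sp n → ℝ) (hf : ContDiff ℝ ∞ f) :
    Dd e (fun p => c * f p) = fun p => c * Dd e f p := by
  funext p
  have h1 := (hf.differentiable (by simp) p).hasFDerivAt
  unfold Dd
  rw [(h1.const_mul c).fderiv]
  simp

lemma Dd_sq {n : ℕ} (e : Sp n) (f : Sp n → ℝ) (hf : ContDiff ℝ ∞ f) :
    Dd e (fun p => f p ^ 2) = fun p => 2 * f p * Dd e f p := by
  simp only [pow_two]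
  rw [Dd_mul e f f hf hf]
  funext p; ring

lemma Dd_exp {n : ℕ} (e : Sp n) (f : Sp n → ℝ) (hf : ContDiff ℝ ∞ f) :
    Dd e (fun p => Real.exp (f p)) = fun p => Real.exp (f p) * Dd e f p := by
  funext p
  have h1 := (hf.differentiable (by simp) p).hasFDerivAt
  unfold Dd
  rw [h1.exp.fderiv]
  simp

lemma Dd_sum {n : ℕ} {ι : Type*} (s : Finset ι) (e : Sp n) (f : ι → Sp n → ℝ)
    (hf : ∀ i, ContDiff ℝ ∞ (f i)) :
    Dd e (fun p => ∑ i ∈ s, f i p) = fun p => ∑ i ∈ s, Dd e (f i) p := by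
  funext p
  have h1 := fun i => ((hf i).differentiable (by simp) p).hasFDerivAt
  unfold Dd
  rw [(HasFDerivAt.fun_sum (u := s) fun i _ => h1 i).fderiv]
  simp

lemma Dd_comm {n : ℕ} (e e' : Sp n) (f : Sp n → ℝ) (hf : ContDiff ℝ ∞ f) (p : Sp n) :
    Dd e (Dd e' f) p = Dd e' (Dd e f) p := by
  have hs : IsSymmSndFDerivAt ℝ f p := hf.contDiffAt.isSymmSndFDerivAt (by simp; exact WithTop.coe_le_coe.2 le_top)
  have hd : DifferentiableAt ℝ (fderiv ℝ f) p :=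
    ((hf.fderiv_right (m := ∞) (by simp)).differentiable (by simp)) p
  have key : ∀ a b : Sp n, Dd a (Dd b f) p = fderiv ℝ (fderiv ℝ f) p a b := by
    intro a b
    unfold Dd
    rw [fderiv_clm_apply hd (differentiableAt_const _)]
    simp
  rw [key, key]
  exact hs e e'

lemma Dd_zero_off {n : ℕ} {K : Set (Sp n)} (hK : IsClosed K) (e : Sp n) (f : Sp n → ℝ)
    (h0 : ∀ p, p ∉ K → f p = 0) : ∀ p, p ∉ K → Dd e f p = 0 := by
  intro p hp
  have : f =ᶠ[𝓝 p] fun _ => (0:ℝ) := by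
    filter_upwards [hK.isOpen_compl.mem_nhds hp] with q hq using h0 q hq
  unfold Dd
  rw [this.fderiv_eq]
  simp

instance volHaar {n : ℕ} : (volume : Measure (Sp n)).IsAddHaarMeasure :=
  Measure.prod.instIsAddHaarMeasure _ _

lemma integrable_off {n : ℕ} {K : Set (Sp n)} (hK : IsCompact K) (f : Sp n → ℝ)
    (hf : Continuous f) (h0 : ∀ p, p ∉ K → f p = 0) : Integrable f :=
  hf.integrable_of_hasCompactSupport (HasCompactSupport.intro hK h0)

lemma Dd_int {n : ℕ} {K : Set (Sp n)} (hK : IsCompact K) (e : Sp n) (f : Sp n → ℝ)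
    (hf : ContDiff ℝ ∞ f) (h0 : ∀ p, p ∉ K → f p = 0) :
    Integrable (Dd e f) ∧ ∫ p, Dd e f p = 0 := by
  have hi := integrable_off hK (Dd e f) (Dd_smooth e f hf).continuous
    (Dd_zero_off hK.isClosed e f h0)
  refine ⟨hi, ?_⟩
  have := integral_mul_fderiv_eq_neg_fderiv_mul_of_integrable (μ := (volume : Measure (Sp n)))
    (f := fun _ => (1:ℝ)) (g := f) (v := e)
    (by simp) (by simp only [one_mul]; exact hi) (by simpa using integrable_off hK f hf.continuous h0)
    (fun x _ => differentiableAt_const _) (fun x _ => hf.differentiable (by simp) x)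
  simpa [Dd] using this

lemma Dd_const {n : ℕ} (e : Sp n) (c : ℝ) : Dd e (fun _ => c) = fun _ => 0 := by
  funext p
  simp [Dd]

/-- zero-mean integrable functions -/
def ZM {n : ℕ} (f : Sp n → ℝ) : Prop := Integrable f ∧ ∫ p, f p = 0

lemma ZM.add {n : ℕ} {f g : Sp n → ℝ} (hf : ZM f) (hg : ZM g) : ZM (fun p => f p + g p) :=
  ⟨hf.1.add hg.1, by rw [integral_add hf.1 hg.1, hf.2, hg.2]; simp⟩

lemma ZM.sub {n : ℕ} {f g : Sp n → ℝ} (hf : ZM f) (hg : ZM g) : ZM (fun p => f p - g p) :=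
  ⟨hf.1.sub hg.1, by rw [integral_sub hf.1 hg.1, hf.2, hg.2]; simp⟩

lemma ZM.sum {n : ℕ} {ι : Type*} (s : Finset ι) {f : ι → Sp n → ℝ} (hf : ∀ i, ZM (f i)) :
    ZM (fun p => ∑ i ∈ s, f i p) :=
  ⟨integrable_finsetSum _ fun i _ => (hf i).1, by
    rw [integral_finsetSum _ fun i _ => (hf i).1]
    exact Finset.sum_eq_zero fun i _ => (hf i).2⟩

def q0 {n : ℕ} (Φ : Sp n → ℝ) (p : Sp n) : ℝ := ∑ i, Dd (ex i) Φ p ^ 2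
def lap0 {n : ℕ} (Φ : Sp n → ℝ) (p : Sp n) : ℝ := ∑ i, Dd (ex i) (Dd (ex i) Φ) p
def hes0 {n : ℕ} (Φ w : Sp n → ℝ) (p : Sp n) : ℝ :=
  ∑ i, ∑ j, Dd (ex i) (Dd (ex j) Φ) p * Dd (ex i) w p * Dd (ex j) w p
def inn0 {n : ℕ} (f g : Sp n → ℝ) (p : Sp n) : ℝ := ∑ i, Dd (ex i) f p * Dd (ex i) g p

@[fun_prop]
lemma q0_smooth {n : ℕ} (f : Sp n → ℝ) (hf : ContDiff ℝ ∞ f) : ContDiff ℝ ∞ (q0 f) := by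
  unfold q0; fun_prop
@[fun_prop]
lemma lap0_smooth {n : ℕ} (f : Sp n → ℝ) (hf : ContDiff ℝ ∞ f) : ContDiff ℝ ∞ (lap0 f) := by
  unfold lap0; fun_prop
@[fun_prop]
lemma hes0_smooth {n : ℕ} (f g : Sp n → ℝ) (hf : ContDiff ℝ ∞ f) (hg : ContDiff ℝ ∞ g) :
    ContDiff ℝ ∞ (hes0 f g) := by
  unfold hes0; fun_prop
@[fun_prop]
lemma inn0_smooth {n : ℕ} (f g : Sp n → ℝ) (hf : ContDiff ℝ ∞ f) (hg : ContDiff ℝ ∞ g) :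
    ContDiff ℝ ∞ (inn0 f g) := by
  unfold inn0; fun_prop

def I0 {n : ℕ} (Φ u : Sp n → ℝ) (p : Sp n) : ℝ :=
  Real.exp (2 * Φ p) * (Dd et u p + lap0 u p) ^ 2
def I1 {n : ℕ} (Φ F v : Sp n → ℝ) (p : Sp n) : ℝ := 4 * hes0 Φ v p + F p * q0 v p
def I2 {n : ℕ} (Φ v : Sp n → ℝ) (p : Sp n) : ℝ :=
  (4 * hes0 Φ Φ p - 2 * Dd et (q0 Φ) p + Dd et (Dd et Φ) p - lap0 (lap0 Φ) p) * v p ^ 2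
def I3 {n : ℕ} (Φ F v : Sp n → ℝ) (p : Sp n) : ℝ :=
  (-(1 / 2) * Dd et F p - (1 / 2) * lap0 F p + inn0 Φ F p
    - F p * (q0 Φ p - Dd et Φ p + F p / 2)) * v p ^ 2

def Sv {n : ℕ} (Φ v : Sp n → ℝ) (p : Sp n) : ℝ := lap0 v p + (q0 Φ p - Dd et Φ p) * v p
def Av {n : ℕ} (Φ v : Sp n → ℝ) (p : Sp n) : ℝ :=
  Dd et v p - 2 * inn0 Φ v p - lap0 Φ p * v p

lemma conj_eq {n : ℕ} (Φ u : Sp n → ℝ) (hΦ : ContDiff ℝ ∞ Φ) (hu : ContDiff ℝ ∞ u) (p : Sp n) :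
    I0 Φ u p = (Sv Φ (fun p => Real.exp (Φ p) * u p) p
      + Av Φ (fun p => Real.exp (Φ p) * u p) p) ^ 2 := by
  have h1 : Sv Φ (fun p => Real.exp (Φ p) * u p) p + Av Φ (fun p => Real.exp (Φ p) * u p) p
      = Real.exp (Φ p) * (Dd et u p + lap0 u p) := by
    unfold Sv Av lap0 q0 inn0
    simp (disch := fun_prop) only [Dd_mul, Dd_exp, Dd_add]
    have : ∀ i : Fin n, Real.exp (Φ p) * Dd (ex i) (Dd (ex i) u) p
      = ((Real.exp (Φ p) * Dd (ex i) Φ p * Dd (ex i) Φ p +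
                Real.exp (Φ p) * Dd (ex i) (Dd (ex i) Φ) p) *
              u p +
            Real.exp (Φ p) * Dd (ex i) Φ p * Dd (ex i) u p +
          (Real.exp (Φ p) * Dd (ex i) Φ p * Dd (ex i) u p +
            Real.exp (Φ p) * Dd (ex i) (Dd (ex i) u) p))
        + Dd (ex i) Φ p ^ 2 * (Real.exp (Φ p) * u p)
        - 2 * (Dd (ex i) Φ p * (Real.exp (Φ p) * Dd (ex i) Φ p * u p +
            Real.exp (Φ p) * Dd (ex i) u p))
        - Dd (ex i) (Dd (ex i) Φ) p * (Real.exp (Φ p) * u p) := by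
      intro i; ring
    rw [mul_add, Finset.mul_sum (f := fun i => Dd (ex i) (Dd (ex i) u) p), Finset.sum_congr rfl fun i _ => this i]
    simp only [Finset.sum_add_distrib, Finset.sum_sub_distrib, ← Finset.sum_mul, ← Finset.mul_sum]
    ring
  rw [h1, I0, mul_pow, ← Real.exp_nat_mul]
  simp

def Rt {n : ℕ} (Φ F v : Sp n → ℝ) : Sp n → ℝ :=
  Dd et (fun p => (q0 Φ p - Dd et Φ p) * v p ^ 2 + (1/2) * (F p * v p ^ 2))
def Ri {n : ℕ} (Φ F v : Sp n → ℝ) (i : Fin n) : Sp n → ℝ := fun p =>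
  Dd (ex i) (fun p => (-2) * ((q0 Φ p - Dd et Φ p) * (Dd (ex i) Φ p * v p ^ 2))
    + 2 * (Dd (ex i) v p * Dd et v p) - F p * (v p * Dd (ex i) v p)
    + (1/2) * (Dd (ex i) F p * v p ^ 2) - F p * (Dd (ex i) Φ p * v p ^ 2)) p
  - Dd et (fun p => Dd (ex i) v p ^ 2) p
def Rij {n : ℕ} (Φ v : Sp n → ℝ) (i j : Fin n) : Sp n → ℝ := fun p =>
  Dd (ex i) (fun p => (-4) * (Dd (ex i) v p * (Dd (ex j) Φ p * Dd (ex j) v p))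
    + (-2) * (Dd (ex i) v p * (Dd (ex j) (Dd (ex j) Φ) p * v p))
    + v p ^ 2 * Dd (ex i) (Dd (ex j) (Dd (ex j) Φ)) p) p
  + Dd (ex j) (fun p => 2 * (Dd (ex i) v p ^ 2 * Dd (ex j) Φ p)) p

lemma Rt_eq {n : ℕ} (Φ F v : Sp n → ℝ) (hΦ : ContDiff ℝ ∞ Φ) (hF : ContDiff ℝ ∞ F)
    (hv : ContDiff ℝ ∞ v) (p : Sp n) : Rt Φ F v p =
      (Dd et (q0 Φ) p - Dd et (Dd et Φ) p) * v p ^ 2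
       + (q0 Φ p - Dd et Φ p) * (2 * v p * Dd et v p)
       + (1/2) * (Dd et F p * v p ^ 2 + F p * (2 * v p * Dd et v p)) := by
  unfold Rt
  simp (disch := fun_prop) only [Dd_mul, Dd_sq, Dd_add, Dd_sub, Dd_const]
  ring

lemma q0_d {n : ℕ} (Φ : Sp n → ℝ) (hΦ : ContDiff ℝ ∞ Φ) (e : Sp n) (p : Sp n) :
    Dd e (q0 Φ) p = ∑ j, 2 * Dd (ex j) Φ p * Dd e (Dd (ex j) Φ) p := by
  unfold q0
  simp (disch := (intros; fun_prop)) only [Dd_sum, Dd_sq]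

lemma Ri_eq {n : ℕ} (Φ F v : Sp n → ℝ) (hΦ : ContDiff ℝ ∞ Φ) (hF : ContDiff ℝ ∞ F)
    (hv : ContDiff ℝ ∞ v) (i : Fin n) (p : Sp n) : Ri Φ F v i p =
      (-2 * v p ^ 2) * ((Dd (ex i) (q0 Φ) p - Dd (ex i) (Dd et Φ) p) * Dd (ex i) Φ p)
      + (-2 * (q0 Φ p - Dd et Φ p) * v p ^ 2 - F p * v p ^ 2) * Dd (ex i) (Dd (ex i) Φ) p
      + (-4 * (q0 Φ p - Dd et Φ p) * v p - 2 * F p * v p) * (Dd (ex i) Φ p * Dd (ex i) v p)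
      + (2 * Dd et v p - F p * v p) * Dd (ex i) (Dd (ex i) v) p
      - F p * Dd (ex i) v p ^ 2
      + (1/2) * v p ^ 2 * Dd (ex i) (Dd (ex i) F) p
      - v p ^ 2 * (Dd (ex i) Φ p * Dd (ex i) F p) := by
  unfold Ri
  simp (disch := fun_prop) only [Dd_mul, Dd_sq, Dd_add, Dd_sub, Dd_const]
  rw [Dd_comm et (ex i) v hv]
  ring

lemma Rij_eq {n : ℕ} (Φ v : Sp n → ℝ) (hΦ : ContDiff ℝ ∞ Φ)
    (hv : ContDiff ℝ ∞ v) (i j : Fin n) (p : Sp n) : Rij Φ v i j p =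
      -4 * (Dd (ex i) (Dd (ex i) v) p * (Dd (ex j) Φ p * Dd (ex j) v p))
      - 2 * v p * (Dd (ex i) (Dd (ex i) v) p * Dd (ex j) (Dd (ex j) Φ) p)
      - 4 * (Dd (ex i) (Dd (ex j) Φ) p * Dd (ex i) v p * Dd (ex j) v p)
      + v p ^ 2 * Dd (ex i) (Dd (ex i) (Dd (ex j) (Dd (ex j) Φ))) p := by
  unfold Rij
  simp (disch := fun_prop) only [Dd_mul, Dd_sq, Dd_add, Dd_sub, Dd_const]
  rw [Dd_comm (ex j) (ex i) v hv]
  ring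

lemma sumRij {n : ℕ} (Φ v : Sp n → ℝ) (hΦ : ContDiff ℝ ∞ Φ)
    (hv : ContDiff ℝ ∞ v) (p : Sp n) : ∑ i, ∑ j, Rij Φ v i j p =
      -4 * (lap0 v p * inn0 Φ v p) - 2 * v p * (lap0 v p * lap0 Φ p)
      - 4 * hes0 Φ v p + v p ^ 2 * lap0 (lap0 Φ) p := by
  have hl : lap0 (lap0 Φ) p = ∑ i, ∑ j, Dd (ex i) (Dd (ex i) (Dd (ex j) (Dd (ex j) Φ))) p := by
    unfold lap0
    simp (disch := (intros; fun_prop)) only [Dd_sum]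
  rw [hl]
  simp only [Rij_eq Φ v hΦ hv, lap0, inn0, hes0, Finset.sum_mul_sum]
  simp only [Finset.mul_sum,
    Finset.sum_add_distrib, Finset.sum_sub_distrib]

lemma sumRi {n : ℕ} (Φ F v : Sp n → ℝ) (hΦ : ContDiff ℝ ∞ Φ) (hF : ContDiff ℝ ∞ F)
    (hv : ContDiff ℝ ∞ v) (p : Sp n) : ∑ i, Ri Φ F v i p =
      (-2 * v p ^ 2) * (2 * hes0 Φ Φ p - (1/2) * Dd et (q0 Φ) p)
      + (-2 * (q0 Φ p - Dd et Φ p) * v p ^ 2 - F p * v p ^ 2) * lap0 Φ p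
      + (-4 * (q0 Φ p - Dd et Φ p) * v p - 2 * F p * v p) * inn0 Φ v p
      + (2 * Dd et v p - F p * v p) * lap0 v p
      - F p * q0 v p
      + (1/2) * v p ^ 2 * lap0 F p
      - v p ^ 2 * inn0 Φ F p := by
  have hm : 2 * hes0 Φ Φ p - (1/2) * Dd et (q0 Φ) p =
      ∑ i, (Dd (ex i) (q0 Φ) p - Dd (ex i) (Dd et Φ) p) * Dd (ex i) Φ p := by
    rw [q0_d Φ hΦ, hes0, Finset.mul_sum, Finset.mul_sum, ← Finset.sum_sub_distrib]
    refine Finset.sum_congr rfl fun i _ => ?_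
    rw [q0_d Φ hΦ, sub_mul, Finset.mul_sum, Finset.sum_mul, Dd_comm et (ex i) Φ hΦ]
    congr 1
    · exact Finset.sum_congr rfl fun j _ => by ring
    · ring
  rw [hm]
  simp only [Ri_eq Φ F v hΦ hF hv]
  simp only [Finset.sum_add_distrib, Finset.sum_sub_distrib, ← Finset.mul_sum]
  simp only [lap0, inn0, q0]

lemma key {n : ℕ} (Φ F v : Sp n → ℝ) (hΦ : ContDiff ℝ ∞ Φ) (hF : ContDiff ℝ ∞ F)
    (hv : ContDiff ℝ ∞ v) (p : Sp n) :
    I1 Φ F v p + I2 Φ v p + I3 Φ F v p + (Rt Φ F v p + ∑ i, Ri Φ F v i p + ∑ i, ∑ j, Rij Φ v i j p)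
      ≤ (Sv Φ v p + Av Φ v p) ^ 2 := by
  rw [Rt_eq Φ F v hΦ hF hv, sumRi Φ F v hΦ hF hv, sumRij Φ v hΦ hv]
  have h1 := sq_nonneg (Sv Φ v p + Av Φ v p)
  have h2 := sq_nonneg (Sv Φ v p - Av Φ v p + F p * v p)
  unfold I1 I2 I3
  unfold Sv Av at *
  linarith

lemma core {n : ℕ} (Φ F u : Sp n → ℝ) (hΦ : ContDiff ℝ ∞ Φ) (hF : ContDiff ℝ ∞ F)
    (hu : ContDiff ℝ ∞ u) {K : Set (Sp n)} (hK : IsCompact K) (h0 : ∀ p, p ∉ K → u p = 0)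
    (v : Sp n → ℝ) (hv' : v = fun p => Real.exp (Φ p) * u p) :
    ∫ p, I0 Φ u p ≥ (∫ p, I1 Φ F v p) + (∫ p, I2 Φ v p) + ∫ p, I3 Φ F v p := by
  have hv : ContDiff ℝ ∞ v := by subst hv'; fun_prop
  have hv0 : ∀ p, p ∉ K → v p = 0 := by intro p hp; simp [hv', h0 p hp]
  have hKc := hK.isClosed
  have hvd : ∀ e, ∀ p, p ∉ K → Dd e v p = 0 := fun e => Dd_zero_off hKc e v hv0
  have hud : ∀ e, ∀ p, p ∉ K → Dd e u p = 0 := fun e => Dd_zero_off hKc e u h0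
  have hudd : ∀ e e', ∀ p, p ∉ K → Dd e' (Dd e u) p = 0 :=
    fun e e' => Dd_zero_off hKc e' _ (hud e)
  have i0 : Integrable (I0 Φ u) := by
    refine integrable_off hK _ ?_ ?_
    · exact ContDiff.continuous (𝕜 := ℝ) (n := ∞) (by unfold I0; fun_prop)
    · intro p hp; simp [I0, lap0, hud _ p hp, hudd _ _ p hp]
  have i1 : Integrable (I1 Φ F v) := by
    refine integrable_off hK _ ?_ ?_
    · exact ContDiff.continuous (𝕜 := ℝ) (n := ∞) (by unfold I1; fun_prop)
    · intro p hp; simp [I1, hes0, q0, hvd _ p hp]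
  have i2 : Integrable (I2 Φ v) := by
    refine integrable_off hK _ ?_ ?_
    · exact ContDiff.continuous (𝕜 := ℝ) (n := ∞) (by unfold I2; fun_prop)
    · intro p hp; simp [I2, hv0 p hp]
  have i3 : Integrable (I3 Φ F v) := by
    refine integrable_off hK _ ?_ ?_
    · exact ContDiff.continuous (𝕜 := ℝ) (n := ∞) (by unfold I3; fun_prop)
    · intro p hp; simp [I3, hv0 p hp]
  have zt : ZM (Rt Φ F v) := by
    refine Dd_int hK _ _ (by fun_prop) ?_
    intro p hp; simp [hv0 p hp]
  have zi : ∀ i, ZM (Ri Φ F v i) := by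
    intro i
    refine ZM.sub (Dd_int hK _ _ (by fun_prop) ?_) (Dd_int hK _ _ (by fun_prop) ?_)
    · intro p hp; simp [hv0 p hp, hvd _ p hp]
    · intro p hp; simp [hvd _ p hp]
  have zij : ∀ i j, ZM (Rij Φ v i j) := by
    intro i j
    refine ZM.add (Dd_int hK _ _ (by fun_prop) ?_) (Dd_int hK _ _ (by fun_prop) ?_)
    · intro p hp; simp [hv0 p hp, hvd _ p hp]
    · intro p hp; simp [hvd _ p hp]
  have z := (zt.add (ZM.sum Finset.univ zi)).add
    (ZM.sum Finset.univ fun i => ZM.sum Finset.univ fun j => zij i j)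
  have hle := integral_mono (((i1.add i2).add i3).add z.1) i0 (fun p => by
    have := key Φ F v hΦ hF hv p
    rw [conj_eq Φ u hΦ hu p, ← hv']
    exact this)
  rw [integral_add' ((i1.add i2).add i3) z.1, integral_add' (i1.add i2) i3, integral_add' i1 i2, z.2]
    at hle
  linarith

section tr
variable {n : ℕ}

lemma tr_t (f : Sp n → ℝ) (hf : ContDiff ℝ ∞ f) (x : EuclideanSpace ℝ (Fin n)) (t : ℝ) :
    deriv (fun s => f (x, s)) t = Dd et f (x, t) := by
  have h1 := (hf.differentiable (by simp) (x, t)).hasFDerivAt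
  have h2 : HasDerivAt (fun s : ℝ => ((x, s) : Sp n)) et t :=
    (hasDerivAt_const t x).prodMk (hasDerivAt_id t)
  exact (h1.comp_hasDerivAt t h2).deriv

lemma tr_x (f : Sp n → ℝ) (hf : ContDiff ℝ ∞ f) (x : EuclideanSpace ℝ (Fin n)) (t : ℝ)
    (ξ : EuclideanSpace ℝ (Fin n)) :
    fderiv ℝ (fun y => f (y, t)) x ξ = Dd (ξ, 0) f (x, t) := by
  have h1 := (hf.differentiable (by simp) (x, t)).hasFDerivAt
  have h2 : HasFDerivAt (fun y => ((y, t) : Sp n)) (ContinuousLinearMap.inl ℝ _ ℝ) x :=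
    hasFDerivAt_prodMk_left x t
  have h3 := (h1.comp x h2).fderiv
  simp only [Function.comp_def] at h3
  rw [h3]
  simp [Dd]

lemma tr_xx (f : Sp n → ℝ) (hf : ContDiff ℝ ∞ f) (x : EuclideanSpace ℝ (Fin n)) (t : ℝ)
    (ξ η : EuclideanSpace ℝ (Fin n)) :
    iteratedFDeriv ℝ 2 (fun y => f (y, t)) x ![ξ, η] = Dd (ξ, 0) (Dd (η, 0) f) (x, t) := by
  rw [iteratedFDeriv_two_apply]
  simp only [Matrix.cons_val_zero, Matrix.cons_val_one]
  have hg : ContDiff ℝ ∞ (fun y : EuclideanSpace ℝ (Fin n) => f (y, t)) := by fun_prop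
  have hd : DifferentiableAt ℝ (fderiv ℝ (fun y => f (y, t))) x :=
    ((hg.fderiv_right (m := ∞) (by simp)).differentiable (by simp)) x
  rw [← tr_x (Dd (η, 0) f) (by fun_prop)]
  have : (fun y => Dd (η, 0) f (y, t)) = fun y => fderiv ℝ (fun y => f (y, t)) y η := by
    funext y; rw [tr_x f hf]
  rw [this, fderiv_clm_apply hd (differentiableAt_const _)]
  simp

lemma tr_lap (f : Sp n → ℝ) (hf : ContDiff ℝ ∞ f) (x : EuclideanSpace ℝ (Fin n)) (t : ℝ) :
    lap (fun y => f (y, t)) x = lap0 f (x, t) := by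
  unfold lap lap0
  exact Finset.sum_congr rfl fun i _ => tr_xx f hf x t _ _

lemma tr_grad (f : Sp n → ℝ) (hf : ContDiff ℝ ∞ f) (x : EuclideanSpace ℝ (Fin n)) (t : ℝ)
    (i : Fin n) : gradient (fun y => f (y, t)) x i = Dd (ex i) f (x, t) := by
  have := tr_x f hf x t (EuclideanSpace.single i 1)
  rw [ex, ← this, ← inner_gradient_left]
  rw [EuclideanSpace.inner_single_right]
  simp

lemma tr_norm (f : Sp n → ℝ) (hf : ContDiff ℝ ∞ f) (x : EuclideanSpace ℝ (Fin n)) (t : ℝ) :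
    ‖gradient (fun y => f (y, t)) x‖ ^ 2 = q0 f (x, t) := by
  rw [EuclideanSpace.norm_sq_eq, q0]
  simp only [tr_grad f hf, Real.norm_eq_abs, sq_abs]

lemma tr_inn (f g : Sp n → ℝ) (hf : ContDiff ℝ ∞ f) (hg : ContDiff ℝ ∞ g)
    (x : EuclideanSpace ℝ (Fin n)) (t : ℝ) :
    ⟪gradient (fun y => f (y, t)) x, gradient (fun y => g (y, t)) x⟫ = inn0 f g (x, t) := by
  rw [PiLp.inner_apply, inn0]
  simp only [tr_grad f hf, tr_grad g hg]
  simp [mul_comm]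

lemma tr_hess (f g : Sp n → ℝ) (hf : ContDiff ℝ ∞ f) (hg : ContDiff ℝ ∞ g)
    (x : EuclideanSpace ℝ (Fin n)) (t : ℝ) :
    hessQ (fun y => f (y, t)) x (gradient (fun y => g (y, t)) x) = hes0 f g (x, t) := by
  unfold hessQ hes0
  set ξ := gradient (fun y => g (y, t)) x with hξ
  have hs : ξ = ∑ i, ξ i • EuclideanSpace.single i (1:ℝ) := by
    have := (EuclideanSpace.basisFun (Fin n) ℝ).sum_repr ξ
    simpa using this.symm
  have hb : ∀ a b : EuclideanSpace ℝ (Fin n), fderiv ℝ (fderiv ℝ (fun y => f (y, t))) x a b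
      = Dd (a, 0) (Dd (b, 0) f) (x, t) := by
    intro a b
    rw [← tr_xx f hf, iteratedFDeriv_two_apply]
    simp
  rw [iteratedFDeriv_two_apply]
  simp only [Matrix.cons_val_zero, Matrix.cons_val_one]
  conv_lhs => rw [hs]
  simp only [map_sum, map_smul, _root_.sum_apply, _root_.smul_apply, hb,
    smul_eq_mul, Finset.mul_sum]
  rw [Finset.sum_comm]
  refine Finset.sum_congr rfl fun i _ => Finset.sum_congr rfl fun j _ => ?_
  rw [← tr_grad g hg, ← tr_grad g hg, ← hξ]
  simp only [ex]
  ring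

lemma exists_ext (Q : Set (Sp n)) (hQ : IsOpen Q) (Φ : Sp n → ℝ)
    (hΦ : ContDiffOn ℝ (⊤ : ℕ∞) Φ Q) {K : Set (Sp n)} (hK : IsCompact K) (hKQ : K ⊆ Q) :
    ∃ Ψ : Sp n → ℝ, ContDiff ℝ ∞ Ψ ∧ ∀ p ∈ K, Φ =ᶠ[𝓝 p] Ψ := by
  obtain ⟨t, ht, hKt, htQ⟩ := exists_compact_between hK hQ hKQ
  obtain ⟨χ, h1, h0, -⟩ := exists_contMDiffMap_one_nhds_of_subset_interior
    (n := (⊤ : ℕ∞)) (modelWithCornersSelf ℝ (Sp n)) hK.isClosed hKt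
  have hχ : ContDiff ℝ ∞ χ := χ.contMDiff.contDiff
  refine ⟨fun p => χ p * Φ p, ?_, ?_⟩
  · rw [contDiff_iff_contDiffAt]
    intro p
    by_cases hp : p ∈ Q
    · exact hχ.contDiffAt.mul (hΦ.contDiffAt (hQ.mem_nhds hp))
    · have : (fun p => χ p * Φ p) =ᶠ[𝓝 p] fun _ => 0 := by
        filter_upwards [ht.isClosed.isOpen_compl.mem_nhds (fun h => hp (htQ h))] with q hq
        rw [h0 q hq, zero_mul]
      exact contDiffAt_const.congr_of_eventuallyEq this
  · intro p hp
    filter_upwards [(eventually_nhdsSet_iff_forall.1 h1) p hp] with q hq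
    rw [hq, one_mul]

lemma ev_x {f g : Sp n → ℝ} {p : Sp n} (h : f =ᶠ[𝓝 p] g) :
    ∀ᶠ y in 𝓝 p.1, f (y, p.2) = g (y, p.2) :=
  (Continuous.tendsto (f := fun y => ((y, p.2) : Sp n)) (by fun_prop) p.1).eventually h

lemma ev_t {f g : Sp n → ℝ} {p : Sp n} (h : f =ᶠ[𝓝 p] g) :
    ∀ᶠ s in 𝓝 p.2, f (p.1, s) = g (p.1, s) :=
  (Continuous.tendsto (f := fun s => ((p.1, s) : Sp n)) (by fun_prop) p.2).eventually h

lemma lap_congr {f g : EuclideanSpace ℝ (Fin n) → ℝ} {x} (h : f =ᶠ[𝓝 x] g) : lap f x = lap g x := by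
  unfold lap
  rw [(h.iteratedFDeriv ℝ 2).eq_of_nhds]

lemma hess_congr {f g : EuclideanSpace ℝ (Fin n) → ℝ} {x} (h : f =ᶠ[𝓝 x] g) (ξ) :
    hessQ f x ξ = hessQ g x ξ := by
  unfold hessQ
  rw [(h.iteratedFDeriv ℝ 2).eq_of_nhds]

end tr

end

/-- the basic integration-by-parts inequality behind the Carleman
estimate. For `Q ⊆ ℝⁿ × ℝ` open, `Φ, F` smooth on `Q`, `u` smooth and compactly
supported in `Q`, `v = e^Φ u`:
`∫_Q e^{2Φ}|∂ₜu + Δu|² ≥ ∫_Q [4⟨D²Φ∇v,∇v⟩ + F|∇v|²]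
  + ∫_Q [4⟨D²Φ∇Φ,∇Φ⟩ − 2∂ₜ(|∇Φ|²) + ∂ₜₜΦ − Δ²Φ] v²
  + ∫_Q [−½∂ₜF − ½ΔF + ∇Φ·∇F − F(|∇Φ|² − ∂ₜΦ + F/2)] v²`. -/
theorem stmt_18 (n : ℕ) (Q : Set (EuclideanSpace ℝ (Fin n) × ℝ)) (hQ : IsOpen Q)
    (Φ F : EuclideanSpace ℝ (Fin n) × ℝ → ℝ)
    (hΦ : ContDiffOn ℝ (⊤ : ℕ∞) Φ Q) (hF : ContDiffOn ℝ (⊤ : ℕ∞) F Q)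
    (u : EuclideanSpace ℝ (Fin n) × ℝ → ℝ)
    (hu : ContDiff ℝ (⊤ : ℕ∞) u) (hu₂ : HasCompactSupport u) (hu₃ : tsupport u ⊆ Q) :
    (∫ p in Q, Real.exp (2 * Φ p)
        * |deriv (fun s => u (p.1, s)) p.2 + lap (fun y => u (y, p.2)) p.1| ^ 2)
      ≥ (∫ p in Q,
            4 * hessQ (fun y => Φ (y, p.2)) p.1
                (gradient (fun y => Real.exp (Φ (y, p.2)) * u (y, p.2)) p.1)
              + F p * ‖gradient (fun y => Real.exp (Φ (y, p.2)) * u (y, p.2)) p.1‖ ^ 2)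
        + (∫ p in Q,
            (4 * hessQ (fun y => Φ (y, p.2)) p.1 (gradient (fun y => Φ (y, p.2)) p.1)
                - 2 * deriv (fun s => ‖gradient (fun y => Φ (y, s)) p.1‖ ^ 2) p.2
                + deriv (deriv (fun s => Φ (p.1, s))) p.2
                - lap (fun y => lap (fun z => Φ (z, p.2)) y) p.1)
              * (Real.exp (Φ p) * u p) ^ 2)
        + ∫ p in Q,
            (-(1 / 2) * deriv (fun s => F (p.1, s)) p.2
                - (1 / 2) * lap (fun y => F (y, p.2)) p.1
                + ⟪gradient (fun y => Φ (y, p.2)) p.1, gradient (fun y => F (y, p.2)) p.1⟫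
                - F p * (‖gradient (fun y => Φ (y, p.2)) p.1‖ ^ 2
                    - deriv (fun s => Φ (p.1, s)) p.2 + F p / 2))
              * (Real.exp (Φ p) * u p) ^ 2 := by
  obtain ⟨Ψ, hΨ, hΦΨ⟩ := exists_ext Q hQ Φ hΦ hu₂ hu₃
  obtain ⟨G, hG, hFG⟩ := exists_ext Q hQ F hF hu₂ hu₃
  set K := tsupport u with hKdef
  have hK : IsCompact K := hu₂
  have hKc := hK.isClosed
  have h0 : ∀ p, p ∉ K → u p = 0 := fun p hp => image_eq_zero_of_notMem_tsupport hp
  obtain ⟨v, hv'⟩ : ∃ v : Sp n → ℝ, v = fun p => Real.exp (Ψ p) * u p := ⟨_, rfl⟩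
  have hv : ContDiff ℝ ∞ v := by subst hv'; fun_prop
  have hv0 : ∀ p, p ∉ K → v p = 0 := by intro p hp; simp [hv', h0 p hp]
  have hvd : ∀ e, ∀ p, p ∉ K → Dd e v p = 0 := fun e => Dd_zero_off hKc e v hv0
  have hud : ∀ e, ∀ p, p ∉ K → Dd e u p = 0 := fun e => Dd_zero_off hKc e u h0
  have hudd : ∀ e e', ∀ p, p ∉ K → Dd e' (Dd e u) p = 0 :=
    fun e e' => Dd_zero_off hKc e' _ (hud e)
  have z0 : ∀ p, p ∉ K → I0 Ψ u p = 0 := by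
    intro p hp; simp [I0, lap0, hud _ p hp, hudd _ _ p hp]
  have z1 : ∀ p, p ∉ K → I1 Ψ G v p = 0 := by
    intro p hp; simp [I1, hes0, q0, hvd _ p hp]
  have z2 : ∀ p, p ∉ K → I2 Ψ v p = 0 := by
    intro p hp; simp [I2, hv0 p hp]
  have z3 : ∀ p, p ∉ K → I3 Ψ G v p = 0 := by
    intro p hp; simp [I3, hv0 p hp]
  have hvx : ∀ p ∈ K, gradient (fun y => Real.exp (Φ (y, p.2)) * u (y, p.2)) p.1
      = gradient (fun y => v (y, p.2)) p.1 := by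
    intro p hp
    refine Filter.EventuallyEq.gradient_eq ?_
    filter_upwards [ev_x (hΦΨ p hp)] with y hy
    rw [hv', hy]
  have hvz : ∀ p, p ∉ K → gradient (fun y => Real.exp (Φ (y, p.2)) * u (y, p.2)) p.1 = 0 := by
    intro p hp
    have hz : u =ᶠ[𝓝 p] fun _ => 0 := by
      filter_upwards [hKc.isOpen_compl.mem_nhds hp] with q hq using h0 q hq
    have : (fun y => Real.exp (Φ (y, p.2)) * u (y, p.2)) =ᶠ[𝓝 p.1] fun _ => (0:ℝ) := by
      filter_upwards [ev_x hz] with y hy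
      rw [hy, mul_zero]
    rw [this.gradient_eq]
    simp [gradient]
  have e0 : ∀ p ∈ Q, Real.exp (2 * Φ p)
        * |deriv (fun s => u (p.1, s)) p.2 + lap (fun y => u (y, p.2)) p.1| ^ 2 = I0 Ψ u p := by
    intro p _
    rw [tr_t u hu, tr_lap u hu, sq_abs]
    by_cases hp : p ∈ K
    · rw [(hΦΨ p hp).eq_of_nhds]; rfl
    · rw [z0 p hp]; simp [lap0, hud _ p hp, hudd _ _ p hp]
  have e1 : ∀ p ∈ Q, 4 * hessQ (fun y => Φ (y, p.2)) p.1
                (gradient (fun y => Real.exp (Φ (y, p.2)) * u (y, p.2)) p.1)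
              + F p * ‖gradient (fun y => Real.exp (Φ (y, p.2)) * u (y, p.2)) p.1‖ ^ 2
              = I1 Ψ G v p := by
    intro p _
    by_cases hp : p ∈ K
    · rw [hvx p hp, hess_congr (ev_x (hΦΨ p hp)), tr_hess Ψ v hΨ hv, tr_norm v hv,
        (hFG p hp).eq_of_nhds]
      rfl
    · rw [z1 p hp, hvz p hp, hessQ, iteratedFDeriv_two_apply]
      simp
  have e2 : ∀ p ∈ Q, (4 * hessQ (fun y => Φ (y, p.2)) p.1 (gradient (fun y => Φ (y, p.2)) p.1)
                - 2 * deriv (fun s => ‖gradient (fun y => Φ (y, s)) p.1‖ ^ 2) p.2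
                + deriv (deriv (fun s => Φ (p.1, s))) p.2
                - lap (fun y => lap (fun z => Φ (z, p.2)) y) p.1)
              * (Real.exp (Φ p) * u p) ^ 2 = I2 Ψ v p := by
    intro p _
    by_cases hp : p ∈ K
    · have hE := hΦΨ p hp
      have a1 : (fun y => Φ (y, p.2)) =ᶠ[𝓝 p.1] fun y => Ψ (y, p.2) := ev_x hE
      have a2 : (fun s => Φ (p.1, s)) =ᶠ[𝓝 p.2] fun s => Ψ (p.1, s) := ev_t hE
      have hEE : ∀ᶠ q in 𝓝 p, Φ =ᶠ[𝓝 q] Ψ := hE.eventuallyEq_nhds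
      have a3 : (fun s => ‖gradient (fun y => Φ (y, s)) p.1‖ ^ 2) =ᶠ[𝓝 p.2]
          fun s => q0 Ψ (p.1, s) := by
        filter_upwards [(Continuous.tendsto (f := fun s => ((p.1, s) : Sp n)) (by fun_prop)
          p.2).eventually hEE] with s hs
        rw [Filter.EventuallyEq.gradient_eq (ev_x hs)]
        exact tr_norm Ψ hΨ p.1 s
      have a4 : (fun y => lap (fun z => Φ (z, p.2)) y) =ᶠ[𝓝 p.1]
          fun y => lap0 Ψ (y, p.2) := by
        filter_upwards [(Continuous.tendsto (f := fun y => ((y, p.2) : Sp n)) (by fun_prop)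
          p.1).eventually hEE] with y hy
        rw [lap_congr (ev_x hy)]
        exact tr_lap Ψ hΨ y p.2
      have a5 : deriv (fun s => Ψ (p.1, s)) = fun s => Dd et Ψ (p.1, s) := by
        funext s; exact tr_t Ψ hΨ _ _
      rw [a1.gradient_eq, hess_congr a1, a3.deriv_eq, a2.deriv.deriv_eq, lap_congr a4, a5,
        tr_hess Ψ Ψ hΨ hΨ, tr_t (q0 Ψ) (by fun_prop), tr_t (Dd et Ψ) (by fun_prop),
        tr_lap (lap0 Ψ) (by fun_prop), hE.eq_of_nhds, I2, hv']
    · rw [z2 p hp, h0 p hp]; simp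
  have e3 : ∀ p ∈ Q, (-(1 / 2) * deriv (fun s => F (p.1, s)) p.2
                - (1 / 2) * lap (fun y => F (y, p.2)) p.1
                + ⟪gradient (fun y => Φ (y, p.2)) p.1, gradient (fun y => F (y, p.2)) p.1⟫
                - F p * (‖gradient (fun y => Φ (y, p.2)) p.1‖ ^ 2
                    - deriv (fun s => Φ (p.1, s)) p.2 + F p / 2))
              * (Real.exp (Φ p) * u p) ^ 2 = I3 Ψ G v p := by
    intro p _
    by_cases hp : p ∈ K
    · have hE := hΦΨ p hp
      have a1 : (fun y => Φ (y, p.2)) =ᶠ[𝓝 p.1] fun y => Ψ (y, p.2) := ev_x hE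
      have a2 : (fun s => Φ (p.1, s)) =ᶠ[𝓝 p.2] fun s => Ψ (p.1, s) := ev_t hE
      have hE' := hFG p hp
      have b1 : (fun y => F (y, p.2)) =ᶠ[𝓝 p.1] fun y => G (y, p.2) := ev_x hE'
      have b2 : (fun s => F (p.1, s)) =ᶠ[𝓝 p.2] fun s => G (p.1, s) := ev_t hE'
      rw [a1.gradient_eq, b1.gradient_eq, a2.deriv_eq, b2.deriv_eq, lap_congr b1,
        tr_t G hG, tr_t Ψ hΨ, tr_lap G hG, tr_inn Ψ G hΨ hG, tr_norm Ψ hΨ, hE.eq_of_nhds,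
        hE'.eq_of_nhds, I3, hv']
    · rw [z3 p hp, h0 p hp]; simp
  have hm := hQ.measurableSet
  have off : ∀ f : Sp n → ℝ, (∀ p, p ∉ K → f p = 0) → ∫ p in Q, f p = ∫ p, f p :=
    fun f hf => setIntegral_eq_integral_of_forall_compl_eq_zero fun p hp =>
      hf p fun h => hp (hu₃ h)
  rw [setIntegral_congr_fun hm e0, setIntegral_congr_fun hm e1, setIntegral_congr_fun hm e2,
    setIntegral_congr_fun hm e3, off _ z0, off _ z1, off _ z2, off _ z3]
  exact core Ψ G u hΨ hG hu hK h0 v hv'
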